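/- arXiv:1405.3132 — 4 statements merged into one kernel-verified Lean document; each statement's English description precedes it below -/
import Mathlib

section
/- Let G be an abelian group, A a finite nonempty subset of G, and n, m ≥ 1 integers. Then |A^{n+m} − Δ_{n+m}(A)| ≥ |A|^m · |A^n − Δ_n(A)| and |A^{n+m} + Δ_{n+m}(A)| ≥ |A|^m · max(|A^n + Δ_n(A)|, |A^n − Δ_n(A)|), where the sums and differences are coordinatewise sumsets in the group G^{n+m} resp. G^n. In particular, |A² − Δ₂(A)| ≥ |A| · |A − A| and |A² + Δ₂(A)| ≥ |A| · max(|A + A|, |A − A|). -/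
open Finset Pointwise

variable {G : Type*} [AddCommGroup G] [DecidableEq G]

/-- The `n`-fold cartesian power `A^n ⊆ G^n`. -/
def APow (A : Finset G) (n : ℕ) : Finset (Fin n → G) := Fintype.piFinset fun _ => A

/-- The diagonal copy `Δ_n(A) = {(a,…,a) : a ∈ A} ⊆ G^n`. -/
def ADiag (A : Finset G) (n : ℕ) : Finset (Fin n → G) := A.image (fun a _ => a)

theorem mem_sub_aux (A : Finset G) (k : ℕ) (y : Fin k → G) :
    y ∈ APow A k - ADiag A k ↔ ∃ a ∈ A, ∀ i, y i + a ∈ A := by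
  simp only [Finset.mem_sub, APow, ADiag, Fintype.mem_piFinset, Finset.mem_image]
  constructor
  · rintro ⟨b, hb, _, ⟨a, ha, rfl⟩, rfl⟩
    exact ⟨a, ha, fun i => by simpa using hb i⟩
  · rintro ⟨a, ha, h⟩
    exact ⟨fun i => y i + a, h, _, ⟨a, ha, rfl⟩, by ext i; simp⟩

theorem mem_add_aux (A : Finset G) (k : ℕ) (y : Fin k → G) :
    y ∈ APow A k + ADiag A k ↔ ∃ a ∈ A, ∀ i, y i - a ∈ A := by
  simp only [Finset.mem_add, APow, ADiag, Fintype.mem_piFinset, Finset.mem_image]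
  constructor
  · rintro ⟨b, hb, _, ⟨a, ha, rfl⟩, rfl⟩
    exact ⟨a, ha, fun i => by simpa using hb i⟩
  · rintro ⟨a, ha, h⟩
    exact ⟨fun i => y i - a, h, _, ⟨a, ha, rfl⟩, by ext i; simp⟩

theorem step_sub (A : Finset G) (k : ℕ) :
    A.card * (APow A k - ADiag A k).card ≤ (APow A (k + 1) - ADiag A (k + 1)).card := by
  have H : ∀ y : Fin k → G, ∃ a, y ∈ APow A k - ADiag A k → a ∈ A ∧ ∀ i, y i + a ∈ A := by
    intro y
    by_cases hy : y ∈ APow A k - ADiag A k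
    · obtain ⟨a, h⟩ := (mem_sub_aux A k y).1 hy
      exact ⟨a, fun _ => h⟩
    · exact ⟨0, fun h => absurd h hy⟩
  choose f hf using H
  rw [← Finset.card_product]
  refine Finset.card_le_card_of_injOn
    (fun p => (Fin.cons (p.1 - f p.2) p.2 : Fin (k + 1) → G)) ?_ ?_
  · rintro ⟨b, y⟩ hp
    obtain ⟨hb, hy⟩ := Finset.mem_product.1 (Finset.mem_coe.1 hp)
    refine Finset.mem_coe.2 ((mem_sub_aux A _ _).2 ⟨f y, (hf y hy).1, fun i => ?_⟩)
    refine Fin.cases ?_ (fun j => ?_) i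
    · simpa using hb
    · simpa using (hf y hy).2 j
  · rintro ⟨b, y⟩ _ ⟨b', y'⟩ _ h
    obtain ⟨h1, h2⟩ := Fin.cons_inj.1 h
    dsimp only at h1 h2
    subst h2
    rw [sub_left_inj.1 h1]

theorem step_add (A : Finset G) (k : ℕ) :
    A.card * (APow A k + ADiag A k).card ≤ (APow A (k + 1) + ADiag A (k + 1)).card := by
  have H : ∀ y : Fin k → G, ∃ a, y ∈ APow A k + ADiag A k → a ∈ A ∧ ∀ i, y i - a ∈ A := by
    intro y
    by_cases hy : y ∈ APow A k + ADiag A k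
    · obtain ⟨a, h⟩ := (mem_add_aux A k y).1 hy
      exact ⟨a, fun _ => h⟩
    · exact ⟨0, fun h => absurd h hy⟩
  choose f hf using H
  rw [← Finset.card_product]
  refine Finset.card_le_card_of_injOn
    (fun p => (Fin.cons (p.1 + f p.2) p.2 : Fin (k + 1) → G)) ?_ ?_
  · rintro ⟨b, y⟩ hp
    obtain ⟨hb, hy⟩ := Finset.mem_product.1 (Finset.mem_coe.1 hp)
    refine Finset.mem_coe.2 ((mem_add_aux A _ _).2 ⟨f y, (hf y hy).1, fun i => ?_⟩)
    refine Fin.cases ?_ (fun j => ?_) i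
    · simpa using hb
    · simpa using (hf y hy).2 j
  · rintro ⟨b, y⟩ _ ⟨b', y'⟩ _ h
    obtain ⟨h1, h2⟩ := Fin.cons_inj.1 h
    dsimp only at h1 h2
    subst h2
    rw [add_left_inj _ |>.1 h1]

theorem step_mixed (A : Finset G) (k : ℕ) :
    A.card * (APow A k - ADiag A k).card ≤ (APow A (k + 1) + ADiag A (k + 1)).card := by
  have H : ∀ y : Fin k → G, ∃ a, y ∈ APow A k - ADiag A k → a ∈ A ∧ ∀ i, y i + a ∈ A := by
    intro y
    by_cases hy : y ∈ APow A k - ADiag A k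
    · obtain ⟨a, h⟩ := (mem_sub_aux A k y).1 hy
      exact ⟨a, fun _ => h⟩
    · exact ⟨0, fun h => absurd h hy⟩
  choose f hf using H
  rw [← Finset.card_product]
  refine Finset.card_le_card_of_injOn
    (fun p => (Fin.cons (f p.2 + p.1) (fun i => p.2 i + (f p.2 + p.1)) : Fin (k + 1) → G)) ?_ ?_
  · rintro ⟨b, y⟩ hp
    obtain ⟨hb, hy⟩ := Finset.mem_product.1 (Finset.mem_coe.1 hp)
    refine Finset.mem_coe.2 ((mem_add_aux A _ _).2 ⟨b, hb, fun i => ?_⟩)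
    refine Fin.cases ?_ (fun j => ?_) i
    · simpa using (hf y hy).1
    · simpa [← add_assoc] using (hf y hy).2 j
  · rintro ⟨b, y⟩ _ ⟨b', y'⟩ _ h
    obtain ⟨h1, h2⟩ := Fin.cons_inj.1 h
    dsimp only at h1 h2
    have h3 : y = y' := by
      ext i
      have h4 := congrFun h2 i
      rw [h1] at h4
      exact add_right_cancel h4
    subst h3
    rw [add_left_cancel h1]

theorem iter_sub (A : Finset G) (n m : ℕ) :
    A.card ^ m * (APow A n - ADiag A n).card ≤ (APow A (n + m) - ADiag A (n + m)).card := by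
  induction m with
  | zero => simp
  | succ m ih =>
    calc _ = A.card * (A.card ^ m * (APow A n - ADiag A n).card) := by ring
      _ ≤ _ := Nat.mul_le_mul_left _ ih
      _ ≤ _ := step_sub A (n + m)

theorem iter_add (A : Finset G) (n m : ℕ) :
    A.card ^ m * (APow A n + ADiag A n).card ≤ (APow A (n + m) + ADiag A (n + m)).card := by
  induction m with
  | zero => simp
  | succ m ih =>
    calc _ = A.card * (A.card ^ m * (APow A n + ADiag A n).card) := by ring
      _ ≤ _ := Nat.mul_le_mul_left _ ih
      _ ≤ _ := step_add A (n + m)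

theorem iter_mixed (A : Finset G) (n m : ℕ) (hm : 1 ≤ m) :
    A.card ^ m * (APow A n - ADiag A n).card ≤ (APow A (n + m) + ADiag A (n + m)).card := by
  obtain ⟨m, rfl⟩ := Nat.exists_eq_add_of_le' hm
  calc _ = A.card * (A.card ^ m * (APow A n - ADiag A n).card) := by ring
    _ ≤ _ := Nat.mul_le_mul_left _ (iter_sub A n m)
    _ ≤ _ := step_mixed A (n + m)

theorem one_sub (A : Finset G) : (A - A).card ≤ (APow A 1 - ADiag A 1).card := by
  refine Finset.card_le_card_of_injOn (fun x _ => x) ?_ (fun x _ y _ h => congrFun h 0)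
  intro x hx
  obtain ⟨b, hb, a, ha, rfl⟩ := Finset.mem_sub.1 (Finset.mem_coe.1 hx)
  exact Finset.mem_coe.2 ((mem_sub_aux A _ _).2 ⟨a, ha, fun i => by simpa using hb⟩)

theorem one_add (A : Finset G) : (A + A).card ≤ (APow A 1 + ADiag A 1).card := by
  refine Finset.card_le_card_of_injOn (fun x _ => x) ?_ (fun x _ y _ h => congrFun h 0)
  intro x hx
  obtain ⟨b, hb, a, ha, rfl⟩ := Finset.mem_add.1 (Finset.mem_coe.1 hx)
  exact Finset.mem_coe.2 ((mem_add_aux A _ _).2 ⟨a, ha, fun i => by simpa using hb⟩)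

theorem stmt_0 (A : Finset G) (hA : A.Nonempty) (n m : ℕ) (hn : 1 ≤ n) (hm : 1 ≤ m) :
    A.card ^ m * (APow A n - ADiag A n).card ≤ (APow A (n + m) - ADiag A (n + m)).card ∧
    A.card ^ m * max (APow A n + ADiag A n).card (APow A n - ADiag A n).card ≤
      (APow A (n + m) + ADiag A (n + m)).card ∧
    A.card * (A - A).card ≤ (APow A 2 - ADiag A 2).card ∧
    A.card * max (A + A).card (A - A).card ≤ (APow A 2 + ADiag A 2).card := by
  refine ⟨iter_sub A n m, ?_, ?_, ?_⟩
  · rw [mul_max_of_nonneg _ _ (Nat.zero_le _)]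
    exact max_le (iter_add A n m) (iter_mixed A n m hm)
  · exact (Nat.mul_le_mul_left _ (one_sub A)).trans (step_sub A 1)
  · rw [mul_max_of_nonneg _ _ (Nat.zero_le _)]
    exact max_le ((Nat.mul_le_mul_left _ (one_add A)).trans (step_add A 1))
      ((Nat.mul_le_mul_left _ (one_sub A)).trans (step_mixed A 1))
end

section
/- There exist absolute constants c > 0 and C > 0 with the following property. Let G be an abelian group, A a finite nonempty subset of G, and M ≥ 2 a real number such that E₃(A) ≥ |A|·E(A)/M. Then there is a subset A' ⊆ A with |A'| ≥ c·E(A)/(|A|²·(M·log₂M)⁵) and |A' − A'| ≤ C·M¹⁵·(log₂M)¹⁶·|A'|. -/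
open Finset Pointwise

universe u

variable {G : Type*} [AddCommGroup G] [DecidableEq G]

/-- `A_s = A ∩ (A - s) = {x ∈ A : x + s ∈ A}`. -/
def stab (A : Finset G) (s : G) : Finset G := A ∩ A.image (fun a => a - s)

/-- `E_k(A) = ∑_{s ∈ G} |A_s|^k` (the summand vanishes off `A - A`). -/
def energyK (k : ℕ) (A : Finset G) : ℕ := ∑ s ∈ A - A, (stab A s).card ^ k

/-- The additive energy `E(A)`. -/
def energy (A : Finset G) : ℕ := energyK 2 A

open Classical in
lemma bsg_graph {α : Type*} (B : Finset α) (bad : α → α → Prop)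
    (h : 8 * (#{x ∈ B ×ˢ B | bad x.1 x.2}) ≤ #B ^ 2) :
    ∃ D : Finset α, D ⊆ B ∧ #B ≤ 2 * #D ∧
      ∀ s ∈ D, ∀ t ∈ D, #B ≤ 2 * #{u ∈ B | ¬ bad s u ∧ ¬ bad t u} := by
  refine ⟨{s ∈ B | 4 * #{u ∈ B | bad s u} ≤ #B}, filter_subset _ _, ?_, ?_⟩
  · have h1 : #{x ∈ B ×ˢ B | bad x.1 x.2} = ∑ s ∈ B, #{u ∈ B | bad s u} := by
      simp only [card_filter, sum_product]
    have h2 : #{s ∈ B | ¬ 4 * #{u ∈ B | bad s u} ≤ #B} * #B ≤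
        4 * ∑ s ∈ B, #{u ∈ B | bad s u} := by
      rw [← smul_eq_mul, ← sum_const, mul_sum]
      refine (sum_le_sum (fun i hi => ?_)).trans
        (sum_le_sum_of_subset (f := fun s => 4 * #{u ∈ B | bad s u}) (filter_subset _ _))
      have := (mem_filter.1 hi).2
      omega
    have h3 := card_filter_add_card_filter_not (s := B) (fun s => 4 * #{u ∈ B | bad s u} ≤ #B)
    rcases Nat.eq_zero_or_pos #B with h0 | h0
    · omega
    · have : 2 * #{s ∈ B | ¬ 4 * #{u ∈ B | bad s u} ≤ #B} ≤ #B := by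
        refine Nat.le_of_mul_le_mul_right ?_ h0
        nlinarith
      omega
  · intro s hs t ht
    have hs := (mem_filter.1 hs).2
    have ht := (mem_filter.1 ht).2
    have h3 : B ⊆ {u ∈ B | ¬ bad s u ∧ ¬ bad t u} ∪ ({u ∈ B | bad s u} ∪ {u ∈ B | bad t u}) := by
      intro u hu
      simp only [mem_union, mem_filter, hu, true_and]
      tauto
    have h4 := card_le_card h3
    have h5 := card_union_le {u ∈ B | ¬ bad s u ∧ ¬ bad t u} ({u ∈ B | bad s u} ∪ {u ∈ B | bad t u})
    have h6 := card_union_le {u ∈ B | bad s u} {u ∈ B | bad t u}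
    omega

lemma mem_stab' {G : Type*} [AddCommGroup G] [DecidableEq G] {A : Finset G} {s a : G} :
    a ∈ stab A s ↔ a ∈ A ∧ a + s ∈ A := by
  simp only [stab, mem_inter, mem_image]
  constructor
  · rintro ⟨h, b, hb, rfl⟩
    simpa [h] using hb
  · rintro ⟨h, h2⟩
    exact ⟨h, _, h2, by simp⟩

open Classical in
lemma bsg_choice {G : Type*} [AddCommGroup G] [DecidableEq G] (A P : Finset G) (hA : A.Nonempty)
    (δ : ℝ) (hδ : 0 < δ) (hP : ∀ s ∈ P, δ * #A ≤ #(stab A s)) :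
    ∃ a ∈ A, δ ^ 2 * (#P : ℝ) ^ 2 / 2 ≤ (#{s ∈ P | a + s ∈ A} : ℝ) ^ 2 ∧
      8 * #{x ∈ {s ∈ P | a + s ∈ A} ×ˢ {s ∈ P | a + s ∈ A} |
        (#(stab A x.1 ∩ stab A x.2) : ℝ) < δ ^ 2 / 16 * #A} ≤ #{s ∈ P | a + s ∈ A} ^ 2 := by
  set b : G → ℕ := fun a => #{s ∈ P | a + s ∈ A} with hb
  set β : G → ℕ := fun a => #{x ∈ {s ∈ P | a + s ∈ A} ×ˢ {s ∈ P | a + s ∈ A} |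
        (#(stab A x.1 ∩ stab A x.2) : ℝ) < δ ^ 2 / 16 * #A} with hβ
  have hn : (0 : ℝ) < #A := by exact_mod_cast hA.card_pos
  have h1 : ∑ a ∈ A, b a = ∑ s ∈ P, #(stab A s) := by
    simp only [hb, card_filter]
    rw [sum_comm]
    refine sum_congr rfl fun s _ => ?_
    rw [← card_filter]
    congr 1
    ext a
    simp [mem_stab']
  have h2 : δ * #A * #P ≤ ∑ a ∈ A, (b a : ℝ) := by
    have : (∑ a ∈ A, (b a : ℝ)) = ∑ s ∈ P, (#(stab A s) : ℝ) := by exact_mod_cast h1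
    rw [this]
    calc δ * #A * #P = ∑ s ∈ P, δ * #A := by simp [mul_comm]
      _ ≤ _ := sum_le_sum hP
  have h3 : δ ^ 2 * (#P : ℝ) ^ 2 * #A ≤ ∑ a ∈ A, (b a : ℝ) ^ 2 := by
    have h4 := sq_sum_le_card_mul_sum_sq (s := A) (f := fun a => (b a : ℝ))
    have h5 : (δ * #A * #P) ^ 2 ≤ (∑ a ∈ A, (b a : ℝ)) ^ 2 := by gcongr
    refine le_of_mul_le_mul_left ?_ hn
    calc _ = (δ * #A * #P) ^ 2 := by ring
      _ ≤ _ := h5.trans h4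
  have h6 : ∑ a ∈ A, β a = ∑ x ∈ {x ∈ P ×ˢ P |
        (#(stab A x.1 ∩ stab A x.2) : ℝ) < δ ^ 2 / 16 * #A}, #(stab A x.1 ∩ stab A x.2) := by
    have e1 : ∀ a, β a = #{x ∈ {x ∈ P ×ˢ P |
        (#(stab A x.1 ∩ stab A x.2) : ℝ) < δ ^ 2 / 16 * #A} | a + x.1 ∈ A ∧ a + x.2 ∈ A} := by
      intro a
      simp only [hβ]
      congr 1
      ext x
      simp only [mem_filter, mem_product]
      tauto
    simp only [e1]
    simp_rw [card_filter (fun x : G × G => _ + x.1 ∈ A ∧ _ + x.2 ∈ A)]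
    rw [sum_comm]
    refine sum_congr rfl fun s _ => ?_
    rw [← card_filter]
    congr 1
    ext a
    simp only [mem_filter, mem_inter, mem_stab']
    tauto
  have h7 : ∑ a ∈ A, (β a : ℝ) ≤ δ ^ 2 / 16 * #A * (#P : ℝ) ^ 2 := by
    have : (∑ a ∈ A, (β a : ℝ)) = ∑ x ∈ {x ∈ P ×ˢ P |
        (#(stab A x.1 ∩ stab A x.2) : ℝ) < δ ^ 2 / 16 * #A},
          (#(stab A x.1 ∩ stab A x.2) : ℝ) := by exact_mod_cast h6
    rw [this]
    calc _ ≤ ∑ x ∈ {x ∈ P ×ˢ P |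
        (#(stab A x.1 ∩ stab A x.2) : ℝ) < δ ^ 2 / 16 * #A}, δ ^ 2 / 16 * #A :=
          sum_le_sum fun x hx => (mem_filter.1 hx).2.le
      _ ≤ ∑ x ∈ P ×ˢ P, δ ^ 2 / 16 * #A :=
          sum_le_sum_of_subset_of_nonneg (filter_subset _ _) (fun _ _ _ => by positivity)
      _ = _ := by simp [card_product]; ring
  have h8 : ∑ a ∈ A, δ ^ 2 * (#P : ℝ) ^ 2 / 2 ≤ ∑ a ∈ A, ((b a : ℝ) ^ 2 - 8 * β a) := by
    rw [sum_sub_distrib, ← mul_sum, sum_const, nsmul_eq_mul]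
    linarith
  obtain ⟨a, ha, h9⟩ := exists_le_of_sum_le hA h8
  refine ⟨a, ha, ?_, ?_⟩
  · have : (0 : ℝ) ≤ β a := by positivity
    change _ ≤ (b a : ℝ) ^ 2
    linarith
  · change 8 * β a ≤ b a ^ 2
    have : (0 : ℝ) ≤ δ ^ 2 * (#P : ℝ) ^ 2 / 2 := by positivity
    have : (8 * β a : ℝ) ≤ (b a : ℝ) ^ 2 := by linarith
    exact_mod_cast this

lemma stab_inter_le {G : Type*} [AddCommGroup G] [DecidableEq G] (A : Finset G) (s t : G) :
    #(stab A s ∩ stab A t) ≤ #(stab A (s - t)) := by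
  refine card_le_card_of_injOn (fun a => a + t) ?_ (fun a _ b _ h => by simpa using h)
  intro a ha
  simp only [coe_inter, Set.mem_inter_iff, mem_coe, mem_stab'] at ha ⊢
  refine ⟨ha.2.2, ?_⟩
  have : a + t + (s - t) = a + s := by abel
  rw [this]; exact ha.1.2

lemma diff_count {G : Type*} [AddCommGroup G] [DecidableEq G] (B D Q : Finset G)
    (h : ∀ s ∈ D, ∀ t ∈ D, #B ≤ 2 * #{u ∈ B | s - u ∈ Q ∧ t - u ∈ Q}) :
    #B * #(D - D) ≤ 2 * #Q ^ 2 := by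
  have h1 : ∀ d ∈ D - D, #B ≤ 2 * #{x ∈ Q ×ˢ Q | x.1 - x.2 = d} := by
    intro d hd
    obtain ⟨s, hs, t, ht, rfl⟩ := mem_sub.1 hd
    refine (h s hs t ht).trans (Nat.mul_le_mul_left 2 ?_)
    refine card_le_card_of_injOn (fun u => (s - u, t - u)) ?_ ?_
    · intro u hu
      have hu := (mem_filter.1 hu).2
      simp [hu]
    · intro u _ v _ h
      simpa using (Prod.ext_iff.1 h).1
  calc #B * #(D - D) = ∑ d ∈ D - D, #B := by simp [mul_comm]
    _ ≤ ∑ d ∈ D - D, 2 * #{x ∈ Q ×ˢ Q | x.1 - x.2 = d} := sum_le_sum h1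
    _ = 2 * ∑ d ∈ D - D, #{x ∈ Q ×ˢ Q | x.1 - x.2 = d} := by rw [mul_sum]
    _ ≤ 2 * #(Q ×ˢ Q) := Nat.mul_le_mul_left 2
        ((sum_card_fiberwise_eq_card_filter (Q ×ˢ Q) (D - D) (fun x => x.1 - x.2)).le.trans
          (card_filter_le _ _))
    _ = 2 * #Q ^ 2 := by rw [card_product, sq]

set_option maxHeartbeats 1000000 in
theorem stmt_1 :
    ∃ c C : ℝ, 0 < c ∧ 0 < C ∧
      ∀ (G : Type u) [AddCommGroup G] [DecidableEq G] (A : Finset G) (M : ℝ),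
        A.Nonempty → 2 ≤ M →
        (A.card : ℝ) * (energy A : ℝ) / M ≤ (energyK 3 A : ℝ) →
        ∃ A' : Finset G, A' ⊆ A ∧
          c * (energy A : ℝ) / ((A.card : ℝ) ^ 2 * (M * Real.logb 2 M) ^ 5) ≤ (A'.card : ℝ) ∧
          ((A' - A').card : ℝ) ≤ C * M ^ 15 * (Real.logb 2 M) ^ 16 * (A'.card : ℝ) := by
  refine ⟨1 / 16, 2 ^ 32, by norm_num, by norm_num, ?_⟩
  intro G _ _ A M hA hM hE
  classical
  have hn : (0 : ℝ) < #A := by exact_mod_cast hA.card_pos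
  have hM0 : 0 < M := by linarith
  have hL : 1 ≤ Real.logb 2 M := by
    rw [Real.le_logb_iff_rpow_le (by norm_num) hM0]
    simpa using hM
  set L := Real.logb 2 M with hLdef
  set n : ℝ := (#A : ℝ) with hndef
  have hEsum : (energy A : ℝ) = ∑ s ∈ A - A, (#(stab A s) : ℝ) ^ 2 := by
    simp [energy, energyK]
  have hE3sum : (energyK 3 A : ℝ) = ∑ s ∈ A - A, (#(stab A s) : ℝ) ^ 3 := by
    simp [energyK]
  set E : ℝ := (energy A : ℝ) with hEdef
  have hE0 : 0 ≤ E := by positivity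
  have hstab : ∀ s, (#(stab A s) : ℝ) ≤ n := fun s => by
    have : #(stab A s) ≤ #A := card_le_card inter_subset_left
    rw [hndef]
    exact_mod_cast this
  set P : Finset G := {s ∈ A - A | 1 / (2 * M) * n ≤ #(stab A s)} with hPdef
  -- lower bound on `P`
  have hP : E / (2 * M) ≤ n ^ 2 * #P := by
    have e1 : (energyK 3 A : ℝ) ≤ #P * n ^ 3 + 1 / (2 * M) * n * E := by
      rw [hE3sum, hEsum, ← sum_filter_add_sum_filter_not (A - A)
        (fun s => 1 / (2 * M) * n ≤ #(stab A s))]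
      refine add_le_add ?_ ?_
      · rw [← nsmul_eq_mul, ← sum_const]
        refine sum_le_sum fun s _ => ?_
        have := hstab s
        gcongr
      · rw [mul_sum]
        refine (sum_le_sum (fun s hs => ?_)).trans
          (sum_le_sum_of_subset_of_nonneg
            (f := fun s => 1 / (2 * M) * n * (#(stab A s) : ℝ) ^ 2) (filter_subset _ _)
            (fun _ _ _ => by positivity))
        have := (not_le.1 (mem_filter.1 hs).2).le
        calc (#(stab A s) : ℝ) ^ 3 = #(stab A s) * (#(stab A s) : ℝ) ^ 2 := by ring
          _ ≤ _ := by gcongr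
    have e2 : n * E / M = 2 * (n * (E / (2 * M))) := by field_simp
    have e3 : 1 / (2 * M) * n * E = n * (E / (2 * M)) := by field_simp
    refine le_of_mul_le_mul_left ?_ hn
    nlinarith
  obtain ⟨a, ha, hb, hbad⟩ := bsg_choice A P hA (1 / (2 * M)) (by positivity)
    (fun s hs => (mem_filter.1 hs).2)
  set B : Finset G := {s ∈ P | a + s ∈ A} with hB
  obtain ⟨D, hDB, hD, hgood⟩ := bsg_graph B
    (fun s t => (#(stab A s ∩ stab A t) : ℝ) < (1 / (2 * M)) ^ 2 / 16 * n) (by convert hbad)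
  set ε : ℝ := (1 / (2 * M)) ^ 2 / 16 with hε
  have hε0 : 0 < ε := by positivity
  set Q : Finset G := {s ∈ A - A | ε * n ≤ #(stab A s)} with hQdef
  have hQ : #Q * (ε * n) ^ 2 ≤ E := by
    rw [hEsum, ← nsmul_eq_mul, ← sum_const]
    refine (sum_le_sum (fun s hs => ?_)).trans
          (sum_le_sum_of_subset_of_nonneg
            (f := fun s => (#(stab A s) : ℝ) ^ 2) (filter_subset _ _)
            (fun _ _ _ => by positivity))
    have := (mem_filter.1 hs).2
    gcongr
  have hmemQ : ∀ s t : G, ¬ ((#(stab A s ∩ stab A t) : ℝ) < ε * n) → s - t ∈ Q := by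
    intro s t h
    have h1 : ε * n ≤ #(stab A (s - t)) :=
      (not_lt.1 h).trans (by exact_mod_cast stab_inter_le A s t)
    refine mem_filter.2 ⟨?_, h1⟩
    have h2 : 0 < #(stab A (s - t)) := by
      have : (0 : ℝ) < #(stab A (s - t)) := lt_of_lt_of_le (by positivity) h1
      exact_mod_cast this
    obtain ⟨x, hx⟩ := card_pos.1 h2
    rw [mem_stab'] at hx
    exact mem_sub.2 ⟨_, hx.2, x, hx.1, by abel⟩
  have hcount := diff_count B D Q (fun s hs t ht => by
    refine (hgood s hs t ht).trans (Nat.mul_le_mul_left 2 (card_le_card ?_))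
    intro u hu
    rw [mem_filter] at hu ⊢
    exact ⟨hu.1, hmemQ _ _ hu.2.1, hmemQ _ _ hu.2.2⟩)
  -- numerics
  have hcountR : (#B : ℝ) * #(D - D) ≤ 2 * (#Q : ℝ) ^ 2 := by exact_mod_cast hcount
  have hDR : (#B : ℝ) ≤ 2 * #D := by exact_mod_cast hD
  set N : ℝ := E / n ^ 2 with hN
  have hN0 : 0 < N := by
    have : 0 < E := by
      rw [hEsum]
      have h0 : (0 : G) ∈ A - A := mem_sub.2 ⟨a, ha, a, ha, by simp⟩
      have : stab A 0 = A := by ext x; simp [mem_stab']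
      have h3 := single_le_sum (f := fun s => (#(stab A s) : ℝ) ^ 2)
        (fun _ _ => by positivity) h0
      simp only [this] at h3
      exact lt_of_lt_of_le (by positivity) h3
    positivity
  have hPN : N / (2 * M) ≤ #P := by
    rw [hN, div_div, mul_comm (n ^ 2), ← div_div, div_le_iff₀ (by positivity)]
    linarith
  have hBN : N / (8 * M ^ 2) ≤ #B := by
    refine (pow_le_pow_iff_left₀ (by positivity) (by positivity) two_ne_zero).1 ?_
    refine le_trans ?_ hb
    have : (N / (2 * M)) ^ 2 ≤ (#P : ℝ) ^ 2 := by gcongr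
    calc (N / (8 * M ^ 2)) ^ 2 = (1 / (2 * M)) ^ 2 * (N / (2 * M)) ^ 2 / 4 := by field_simp; norm_num
      _ ≤ (1 / (2 * M)) ^ 2 * (N / (2 * M)) ^ 2 / 2 := by
        have : 0 ≤ (1 / (2 * M)) ^ 2 * (N / (2 * M)) ^ 2 := by positivity
        linarith
      _ ≤ _ := by gcongr
  have hDN : N / (16 * M ^ 2) ≤ #D := by
    have : N / (16 * M ^ 2) = N / (8 * M ^ 2) / 2 := by field_simp; norm_num
    linarith
  have hQN : (#Q : ℝ) ≤ 4096 * M ^ 4 * N := by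
    have : 4096 * M ^ 4 * N = E / (ε * n) ^ 2 := by
      rw [hN, hε]; field_simp; ring
    rw [this, le_div_iff₀ (by positivity)]
    exact hQ
  have hBpos : (0 : ℝ) < #B := lt_of_lt_of_le (by positivity) hBN
  have hdouble : (#(D - D) : ℝ) ≤ 2 ^ 32 * M ^ 12 * #D := by
    refine le_of_mul_le_mul_left ?_ hBpos
    calc (#B : ℝ) * #(D - D) ≤ 2 * (#Q : ℝ) ^ 2 := hcountR
      _ ≤ 2 * (4096 * M ^ 4 * N) ^ 2 := by gcongr
      _ = 2 ^ 32 * M ^ 12 * (N / (8 * M ^ 2) * (N / (16 * M ^ 2))) := by field_simp; norm_num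
      _ ≤ 2 ^ 32 * M ^ 12 * (#B * #D) := by gcongr
      _ = _ := by ring
  have hcard : #(D.image (fun s => a + s)) = #D :=
    card_image_of_injective _ (add_right_injective a)
  refine ⟨D.image (fun s => a + s), ?_, ?_, ?_⟩
  · intro x hx
    obtain ⟨s, hs, rfl⟩ := mem_image.1 hx
    exact (mem_filter.1 (hDB hs)).2
  · rw [hcard]
    refine le_trans ?_ hDN
    have h1 : M ^ 2 ≤ (M * L) ^ 5 := by
      calc M ^ 2 ≤ M ^ 5 := pow_le_pow_right₀ (by linarith) (by norm_num)
        _ ≤ (M * L) ^ 5 := by exact pow_le_pow_left₀ hM0.le (le_mul_of_one_le_right hM0.le hL) 5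
    calc 1 / 16 * E / (n ^ 2 * (M * L) ^ 5) = N / (16 * (M * L) ^ 5) := by
          rw [hN]; field_simp
      _ ≤ N / (16 * M ^ 2) := div_le_div_of_nonneg_left hN0.le (by positivity) (by linarith)
  · have hsub : D.image (fun s => a + s) - D.image (fun s => a + s) ⊆ D - D := by
      intro x hx
      obtain ⟨y, hy, z, hz, rfl⟩ := mem_sub.1 hx
      obtain ⟨s, hs, rfl⟩ := mem_image.1 hy
      obtain ⟨t, ht, rfl⟩ := mem_image.1 hz
      exact mem_sub.2 ⟨s, hs, t, ht, by abel⟩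
    rw [hcard]
    have h1 : (#(D.image (fun s => a + s) - D.image (fun s => a + s)) : ℝ) ≤ #(D - D) := by
      exact_mod_cast card_le_card hsub
    refine (h1.trans hdouble).trans ?_
    have h2 : M ^ 12 ≤ M ^ 15 * L ^ 16 := by
      have h3 : M ^ 12 ≤ M ^ 15 := pow_le_pow_right₀ (by linarith) (by norm_num)
      have h4 : 1 ≤ L ^ 16 := one_le_pow₀ hL
      have : 0 ≤ M ^ 15 := by positivity
      nlinarith
    have h5 : (0 : ℝ) ≤ #D := by positivity
    rw [mul_assoc (2 ^ 32) (M ^ 15)]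
    exact mul_le_mul_of_nonneg_right (mul_le_mul_of_nonneg_left h2 (by norm_num)) h5
end

section
/- Let G be an abelian group, A a finite nonempty subset of G, k ≥ 1 an integer, D = A − A and S = A + A. Then Σ_{x∈D} |D ∩ (D − x)|^k ≥ |A^{k+1} − Δ_{k+1}(A)| ≥ |A − A| · |A|^k, and Σ_{x∈D} |S ∩ (S − x)|^k ≥ |A|^{k−1} · |A² + Δ₂(A)| ≥ |A|^k · max(|A − A|, |A + A|). -/
open Finset Pointwise

variable {G : Type*} [AddCommGroup G] [DecidableEq G]

theorem mem_stab_iff {G : Type*} [AddCommGroup G] [DecidableEq G] (B : Finset G) (x y : G) :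
    y ∈ stab B x ↔ y ∈ B ∧ y + x ∈ B := by
  simp only [stab, Finset.mem_inter, Finset.mem_image]
  refine and_congr_right fun _ => ⟨?_, fun h => ⟨y + x, h, by abel⟩⟩
  rintro ⟨a, ha, rfl⟩
  simpa using ha

theorem mem_sub_diag {G : Type*} [AddCommGroup G] [DecidableEq G] (A : Finset G) (n : ℕ)
    (v : Fin n → G) :
    v ∈ APow A n - ADiag A n ↔ ∃ a : Fin n → G, (∀ i, a i ∈ A) ∧ ∃ b ∈ A, ∀ i, v i = a i - b := by
  simp only [Finset.mem_sub, APow, ADiag, Fintype.mem_piFinset, Finset.mem_image]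
  constructor
  · rintro ⟨a, ha, _, ⟨b, hb, rfl⟩, rfl⟩
    exact ⟨a, ha, b, hb, fun i => rfl⟩
  · rintro ⟨a, ha, b, hb, h⟩
    exact ⟨a, ha, _, ⟨b, hb, rfl⟩, (funext h).symm⟩

theorem mem_add_diag {G : Type*} [AddCommGroup G] [DecidableEq G] (A : Finset G) (n : ℕ)
    (v : Fin n → G) :
    v ∈ APow A n + ADiag A n ↔ ∃ a : Fin n → G, (∀ i, a i ∈ A) ∧ ∃ b ∈ A, ∀ i, v i = a i + b := by
  simp only [Finset.mem_add, APow, ADiag, Fintype.mem_piFinset, Finset.mem_image]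
  constructor
  · rintro ⟨a, ha, _, ⟨b, hb, rfl⟩, rfl⟩
    exact ⟨a, ha, b, hb, fun i => rfl⟩
  · rintro ⟨a, ha, b, hb, h⟩
    exact ⟨a, ha, _, ⟨b, hb, rfl⟩, (funext h).symm⟩

theorem part_one {G : Type*} [AddCommGroup G] [DecidableEq G] (A : Finset G) (k : ℕ) :
    (APow A (k + 1) - ADiag A (k + 1)).card ≤ ∑ x ∈ A - A, (stab (A - A) x).card ^ k := by
  have h : ∑ x ∈ A - A, (stab (A - A) x).card ^ k =
      ((A - A).sigma fun x => Fintype.piFinset fun _ : Fin k => stab (A - A) x).card := by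
    rw [Finset.card_sigma]
    simp
  rw [h]
  refine Finset.card_le_card_of_injOn
    (fun v => (⟨v 0, fun i => v i.succ - v 0⟩ : (_ : G) × (Fin k → G))) ?_ ?_
  · intro v hv
    obtain ⟨a, ha, b, hb, hab⟩ := (mem_sub_diag A _ v).1 hv
    simp only [Finset.mem_coe, Finset.mem_sigma, Fintype.mem_piFinset, mem_stab_iff]
    refine ⟨?_, fun i => ⟨?_, ?_⟩⟩
    · rw [hab]; exact Finset.sub_mem_sub (ha _) hb
    · rw [hab, hab, sub_sub_sub_cancel_right]; exact Finset.sub_mem_sub (ha _) (ha _)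
    · rw [sub_add_cancel, hab]; exact Finset.sub_mem_sub (ha _) hb
  · intro v _ w _ hvw
    simp only [Sigma.mk.injEq, heq_eq_eq] at hvw
    obtain ⟨h0, h1⟩ := hvw
    funext i
    refine Fin.cases h0 (fun j => ?_) i
    have := congrFun h1 j
    simp only [h0] at this
    exact sub_left_injective this

theorem part_two {G : Type*} [AddCommGroup G] [DecidableEq G] (A : Finset G) (k : ℕ) :
    (A - A).card * A.card ^ k ≤ (APow A (k + 1) - ADiag A (k + 1)).card := by
  have hch : ∀ d : G, ∃ b : G, d ∈ A - A → b ∈ A ∧ d + b ∈ A := by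
    intro d
    by_cases hd : d ∈ A - A
    · obtain ⟨a, ha, b, hb, rfl⟩ := Finset.mem_sub.1 hd
      exact ⟨b, fun _ => ⟨hb, by simpa using ha⟩⟩
    · exact ⟨0, fun h => absurd h hd⟩
  choose b hb using hch
  have h : (A - A).card * A.card ^ k =
      ((A - A) ×ˢ Fintype.piFinset fun _ : Fin k => A).card := by
    rw [Finset.card_product]; simp
  rw [h]
  refine Finset.card_le_card_of_injOn
    (fun p => (Fin.cons p.1 (fun i => p.2 i - b p.1) : Fin (k + 1) → G)) ?_ ?_
  · rintro ⟨d, c⟩ hp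
    simp only [Finset.mem_coe, Finset.mem_product, Fintype.mem_piFinset] at hp
    obtain ⟨hd, hc⟩ := hp
    refine Finset.mem_coe.2 ((mem_sub_diag A _ _).2
      ⟨Fin.cons (d + b d) c, ?_, b d, (hb d hd).1, ?_⟩)
    · intro i
      refine Fin.cases ?_ (fun j => ?_) i
      · simpa using (hb d hd).2
      · simpa using hc j
    · intro i
      refine Fin.cases ?_ (fun j => ?_) i <;> simp
  · rintro ⟨d, c⟩ _ ⟨d', c'⟩ _ hh
    obtain ⟨h0, h1⟩ := Fin.cons_inj.1 hh
    simp only at h0 h1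
    subst h0
    congr 1
    funext j
    exact sub_left_injective (congrFun h1 j)

theorem part_three {G : Type*} [AddCommGroup G] [DecidableEq G] (A : Finset G) (k : ℕ)
    (hk : 1 ≤ k) :
    A.card ^ (k - 1) * (APow A 2 + ADiag A 2).card ≤
        ∑ x ∈ A - A, (stab (A + A) x).card ^ k := by
  have h1 : (APow A 2 + ADiag A 2).card ≤ ∑ x ∈ A - A, (stab (A + A) x).card := by
    rw [← Finset.card_sigma]
    refine Finset.card_le_card_of_injOn
      (fun v => (⟨v 1 - v 0, v 0⟩ : (_ : G) × G)) ?_ ?_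
    · intro v hv
      obtain ⟨a, ha, b, hb, hab⟩ := (mem_add_diag A _ v).1 hv
      simp only [Finset.mem_coe, Finset.mem_sigma, mem_stab_iff]
      refine ⟨?_, ?_, ?_⟩
      · rw [hab, hab, add_sub_add_right_eq_sub]; exact Finset.sub_mem_sub (ha _) (ha _)
      · rw [hab]; exact Finset.add_mem_add (ha _) hb
      · rw [add_sub_cancel, hab]; exact Finset.add_mem_add (ha _) hb
    · intro v _ w _ hvw
      simp only [Sigma.mk.injEq, heq_eq_eq] at hvw
      obtain ⟨h1, h0⟩ := hvw
      rw [h0] at h1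
      funext i
      fin_cases i
      · exact h0
      · exact sub_left_injective h1
  have h2 : ∀ x ∈ A - A, A.card ≤ (stab (A + A) x).card := by
    intro x hx
    obtain ⟨a, ha, b, hb, rfl⟩ := Finset.mem_sub.1 hx
    refine Finset.card_le_card_of_injOn (fun c => b + c) ?_ ?_
    · intro c hc
      refine Finset.mem_coe.2 ((mem_stab_iff _ _ _).2 ⟨Finset.add_mem_add hb hc, ?_⟩)
      have : b + c + (a - b) = a + c := by abel
      rw [this]
      exact Finset.add_mem_add ha hc
    · intro c _ c' _ h
      exact add_right_injective b h
  calc _ ≤ A.card ^ (k - 1) * ∑ x ∈ A - A, (stab (A + A) x).card := Nat.mul_le_mul_left _ h1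
    _ = ∑ x ∈ A - A, A.card ^ (k - 1) * (stab (A + A) x).card := Finset.mul_sum _ _ _
    _ ≤ _ := by
      refine Finset.sum_le_sum fun x hx => ?_
      obtain ⟨m, rfl⟩ : ∃ m, k = m + 1 := ⟨k - 1, by omega⟩
      rw [pow_succ, Nat.add_sub_cancel]
      exact Nat.mul_le_mul_right _ (Nat.pow_le_pow_left (h2 x hx) _)

theorem part_four_sub {G : Type*} [AddCommGroup G] [DecidableEq G] (A : Finset G) :
    A.card * (A - A).card ≤ (APow A 2 + ADiag A 2).card := by
  have hch : ∀ d : G, ∃ b : G, d ∈ A - A → b ∈ A ∧ d + b ∈ A := by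
    intro d
    by_cases hd : d ∈ A - A
    · obtain ⟨a, ha, b, hb, rfl⟩ := Finset.mem_sub.1 hd
      exact ⟨b, fun _ => ⟨hb, by simpa using ha⟩⟩
    · exact ⟨0, fun h => absurd h hd⟩
  choose b hb using hch
  rw [← Finset.card_product]
  refine Finset.card_le_card_of_injOn
    (fun p => (![p.2 + b p.2 + p.1, b p.2 + p.1] : Fin 2 → G)) ?_ ?_
  · rintro ⟨c, d⟩ hp
    simp only [Finset.mem_coe, Finset.mem_product] at hp
    obtain ⟨hc, hd⟩ := hp
    refine Finset.mem_coe.2 ((mem_add_diag A _ _).2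
      ⟨![d + b d, b d], ?_, c, hc, ?_⟩)
    · intro i
      fin_cases i
      · simpa using (hb d hd).2
      · simpa using (hb d hd).1
    · intro i
      fin_cases i <;> simp
  · rintro ⟨c, d⟩ _ ⟨c', d'⟩ _ hh
    have h0 : d + b d + c = d' + b d' + c' := congrFun hh 0
    have h1 : b d + c = b d' + c' := congrFun hh 1
    rw [add_assoc, add_assoc, h1] at h0
    have hd : d = d' := add_left_injective _ h0
    subst hd
    rw [add_right_injective _ h1]

theorem part_four_add {G : Type*} [AddCommGroup G] [DecidableEq G] (A : Finset G) :
    A.card * (A + A).card ≤ (APow A 2 + ADiag A 2).card := by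
  have hch : ∀ d : G, ∃ b : G, d ∈ A + A → b ∈ A ∧ d - b ∈ A := by
    intro d
    by_cases hd : d ∈ A + A
    · obtain ⟨a, ha, b, hb, rfl⟩ := Finset.mem_add.1 hd
      exact ⟨b, fun _ => ⟨hb, by simpa using ha⟩⟩
    · exact ⟨0, fun h => absurd h hd⟩
  choose b hb using hch
  rw [← Finset.card_product]
  refine Finset.card_le_card_of_injOn
    (fun p => (![p.2, p.1 + b p.2] : Fin 2 → G)) ?_ ?_
  · rintro ⟨c, d⟩ hp
    simp only [Finset.mem_coe, Finset.mem_product] at hp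
    obtain ⟨hc, hd⟩ := hp
    refine Finset.mem_coe.2 ((mem_add_diag A _ _).2
      ⟨![d - b d, c], ?_, b d, (hb d hd).1, ?_⟩)
    · intro i
      fin_cases i
      · simpa using (hb d hd).2
      · simpa using hc
    · intro i
      fin_cases i <;> simp
  · rintro ⟨c, d⟩ _ ⟨c', d'⟩ _ hh
    have h0 : d = d' := congrFun hh 0
    have h1 : c + b d = c' + b d' := congrFun hh 1
    subst h0
    rw [add_left_injective _ h1]

theorem stmt_7 (A : Finset G) (hA : A.Nonempty) (k : ℕ) (hk : 1 ≤ k) :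
    ((APow A (k + 1) - ADiag A (k + 1)).card ≤
        ∑ x ∈ A - A, (stab (A - A) x).card ^ k ∧
      (A - A).card * A.card ^ k ≤ (APow A (k + 1) - ADiag A (k + 1)).card) ∧
    (A.card ^ (k - 1) * (APow A 2 + ADiag A 2).card ≤
        ∑ x ∈ A - A, (stab (A + A) x).card ^ k ∧
      A.card ^ k * max (A - A).card (A + A).card ≤
        A.card ^ (k - 1) * (APow A 2 + ADiag A 2).card) := by
  refine ⟨⟨part_one A k, part_two A k⟩, part_three A k hk, ?_⟩
  obtain ⟨m, rfl⟩ : ∃ m, k = m + 1 := ⟨k - 1, by omega⟩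
  rw [pow_succ, Nat.add_sub_cancel, mul_assoc]
  refine Nat.mul_le_mul_left _ ?_
  rcases max_choice (A - A).card (A + A).card with h | h <;> rw [h]
  · exact part_four_sub A
  · exact part_four_add A
end

section
/- Let G be an abelian group, A a finite nonempty subset of G, D = A − A and S = A + A. Then E₃(D,A,A)² · |A − A|² · E(A) ≥ |A|¹³ and E₃(S,A,A)² · |A − A|² · E(A) ≥ |A|¹³. -/
open Finset Pointwise

variable {G : Type*} [AddCommGroup G] [DecidableEq G]

/-- `E₃(B,A,A) = ∑_{x ∈ G} |B ∩ (B - x)| ⬝ |A ∩ (A - x)|²`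
(the summand vanishes off `B - B`). -/
def energy3b (B A : Finset G) : ℕ := ∑ x ∈ B - B, (stab B x).card * (stab A x).card ^ 2


/-- Indicator of a finite set, real valued. -/
noncomputable def ind8 (A : Finset G) (x : G) : ℝ := if x ∈ A then 1 else 0

/-- Real-valued autocorrelation. -/
noncomputable def cor8 (A : Finset G) (s : G) : ℝ := ∑ x ∈ A, ind8 A (x + s)

lemma stab_card8 (A : Finset G) (s : G) : ((stab A s).card : ℝ) = cor8 A s := by
  have h : stab A s = A.filter (fun x => x + s ∈ A) := by
    ext x
    simp only [stab, mem_inter, mem_image, mem_filter]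
    constructor
    · rintro ⟨h1, a, ha, rfl⟩
      exact ⟨h1, by simpa using ha⟩
    · rintro ⟨h1, h2⟩
      exact ⟨h1, x + s, h2, by simp⟩
  rw [h, cor8]
  simp [ind8]

lemma sum_diff8 (C : Finset G) (h : G → ℝ) :
    ∑ d ∈ C, ∑ d' ∈ C, h (d - d') = ∑ s ∈ C - C, cor8 C s * h s := by
  have e1 : ∀ s, cor8 C s * h s = ∑ d' ∈ C, ∑ d ∈ C, if d - d' = s then h s else 0 := by
    intro s
    rw [cor8, sum_mul]
    refine sum_congr rfl fun x _ => ?_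
    have : ∀ d, (d - x = s) ↔ (d = x + s) := fun d => by rw [sub_eq_iff_eq_add, add_comm]
    simp only [this, ind8]
    rw [Finset.sum_ite_eq' C (x + s) (fun _ => h s)]
    split_ifs <;> simp
  simp only [e1]
  rw [sum_comm, sum_comm (s := C - C)]
  refine sum_congr rfl fun d' hd' => ?_
  rw [sum_comm]
  refine sum_congr rfl fun d hd => ?_
  rw [Finset.sum_ite_eq, if_pos (sub_mem_sub hd hd')]

lemma shift8 (A C : Finset G) (z : G) (hz : ∀ x ∈ A, x + z ∈ C) (f : G → ℝ)
    (hf : ∀ x, x ∉ A → f x = 0) : ∑ d ∈ C, f (d - z) = ∑ x ∈ A, f x := by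
  symm
  have : ∑ x ∈ A, f x = ∑ d ∈ A.image (fun x => x + z), f (d - z) := by
    rw [sum_image (by intro a _ b _ h; simpa using h)]
    simp
  rw [this]
  refine sum_subset ?_ ?_
  · intro d hd
    obtain ⟨x, hx, rfl⟩ := mem_image.1 hd
    exact hz x hx
  · intro d _ hd
    apply hf
    intro h
    exact hd (mem_image.2 ⟨_, h, by simp⟩)

lemma refl8 (A C : Finset G) (z : G) (hz : ∀ x ∈ A, z - x ∈ C) (f : G → ℝ)
    (hf : ∀ x, x ∉ A → f x = 0) : ∑ d ∈ C, f (z - d) = ∑ x ∈ A, f x := by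
  symm
  have : ∑ x ∈ A, f x = ∑ d ∈ A.image (fun x => z - x), f (z - d) := by
    rw [sum_image (by intro a _ b _ h; simpa using h)]
    simp
  rw [this]
  refine sum_subset ?_ ?_
  · intro d hd
    obtain ⟨x, hx, rfl⟩ := mem_image.1 hd
    exact hz x hx
  · intro d _ hd
    apply hf
    intro h
    exact hd (mem_image.2 ⟨_, h, by simp⟩)

lemma cor8_nonneg (A : Finset G) (s : G) : 0 ≤ cor8 A s :=
  sum_nonneg fun x _ => by unfold ind8; split_ifs <;> norm_num

lemma cor8_neg (A : Finset G) (s : G) : cor8 A (-s) = cor8 A s := by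
  have key : ∀ s, cor8 A s = ∑ x ∈ A, ∑ y ∈ A, if x + s = y then (1:ℝ) else 0 := by
    intro s
    refine sum_congr rfl fun x _ => ?_
    rw [Finset.sum_ite_eq]; rfl
  rw [key, key, sum_comm]
  refine sum_congr rfl fun x _ => sum_congr rfl fun y _ => ?_
  have : (y + -s = x) ↔ (x + s = y) := by
    constructor
    · rintro rfl; simp
    · rintro rfl; simp
  simp only [this]

lemma cor8_neg_set (A : Finset G) (s : G) : cor8 (-A) s = cor8 A s := by
  rw [← cor8_neg A s, cor8, cor8]
  rw [← Finset.image_neg_eq_neg, sum_image (by intro a _ b _ h; simpa using h)]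
  refine sum_congr rfl fun x _ => ?_
  simp only [ind8, Finset.image_neg_eq_neg, Finset.mem_neg']
  simp [add_comm]

lemma ind8_sq (A : Finset G) (x : G) : ind8 A x ^ 2 = ind8 A x := by
  unfold ind8; split_ifs <;> norm_num

lemma ind8_nonneg (A : Finset G) (x : G) : 0 ≤ ind8 A x := by
  unfold ind8; split_ifs <;> norm_num

lemma ind8_off (A : Finset G) (x : G) (h : x ∉ A) : ind8 A x = 0 := by
  simp [ind8, h]

lemma ind8_on (A : Finset G) (x : G) (h : x ∈ A) : ind8 A x = 1 := by
  simp [ind8, h]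

/-- Step 3 : quadratic form lower bound. -/
lemma step3 (A : Finset G) (φ : G → ℝ) :
    ((A.card : ℝ) * ∑ x ∈ A, φ x) ^ 2 ≤
      ((A - A).card : ℝ) * ∑ x ∈ A, ∑ y ∈ A, cor8 A (x - y) * (φ x * φ y) := by
  set ψ : G → ℝ := fun e => ∑ x ∈ A, φ x * ind8 A (x - e) with hψ
  have h1 : ∑ e ∈ A - A, ψ e = (A.card : ℝ) * ∑ x ∈ A, φ x := by
    rw [hψ, sum_comm, mul_sum]
    refine sum_congr rfl fun x hx => ?_
    rw [← mul_sum, refl8 A (A - A) x (fun u hu => sub_mem_sub hx hu) _ (ind8_off A)]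
    rw [sum_congr rfl (fun u hu => ind8_on A u hu)]
    simp [mul_comm]
  have h2 : ∑ e ∈ A - A, ψ e ^ 2 = ∑ x ∈ A, ∑ y ∈ A, cor8 A (x - y) * (φ x * φ y) := by
    simp only [hψ, sq, sum_mul_sum]
    rw [sum_comm]
    refine sum_congr rfl fun x hx => ?_
    rw [sum_comm]
    refine sum_congr rfl fun y hy => ?_
    have := refl8 A (A - A) x (fun u hu => sub_mem_sub hx hu)
      (fun u => ind8 A u * ind8 A (u + (y - x))) (fun u hu => by simp [ind8_off A u hu])
    have h3 : cor8 A (x - y) = ∑ u ∈ A, ind8 A u * ind8 A (u + (y - x)) := by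
      rw [← cor8_neg, neg_sub, cor8]
      exact sum_congr rfl fun u hu => by rw [ind8_on A u hu, one_mul]
    rw [h3, ← this, sum_mul]
    refine sum_congr rfl fun e _ => ?_
    rw [show x - e + (y - x) = y - e by abel]
    ring
  rw [← h1, ← h2]
  exact sq_sum_le_card_mul_sum_sq

lemma sum3 {α : Type*} (P Q R : Finset α) (F : α → α → α → ℝ) :
    ∑ z ∈ P, ∑ x ∈ Q, ∑ y ∈ R, F z x y = ∑ x ∈ Q, ∑ y ∈ R, ∑ z ∈ P, F z x y := by
  rw [sum_comm]
  exact sum_congr rfl fun x _ => sum_comm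

lemma sum4 {α : Type*} (B A : Finset α) (F : α → α → α → α → ℝ) :
    ∑ z ∈ B, ∑ z' ∈ B, ∑ x ∈ A, ∑ y ∈ A, F z z' x y =
      ∑ x ∈ A, ∑ y ∈ A, ∑ z ∈ B, ∑ z' ∈ B, F z z' x y := by
  rw [sum_congr rfl fun z _ => sum3 B A A (F z), sum3 B A A]

/-- Step W. -/
lemma stepW (A B C : Finset G) (hC : ∀ x ∈ A, ∀ z ∈ B, x + z ∈ C)
    (hB : ∀ s, cor8 B s = cor8 A s) (φ : G → ℝ) (hφ : ∀ x, x ∉ A → φ x = 0) :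
    ∑ d ∈ C, ∑ d' ∈ C, (∑ z ∈ B, φ (d - z) * φ (d' - z)) ^ 2 ≤
      ∑ x ∈ A, ∑ y ∈ A, cor8 A (x - y) ^ 2 * (φ x ^ 2 * φ y ^ 2) := by
  have e1 : ∑ d ∈ C, ∑ d' ∈ C, (∑ z ∈ B, φ (d - z) * φ (d' - z)) ^ 2 =
      ∑ z ∈ B, ∑ z' ∈ B, (∑ d ∈ C, φ (d - z) * φ (d - z')) ^ 2 := by
    simp only [sq, sum_mul_sum]
    have : ∀ d ∈ C, ∑ d' ∈ C, ∑ z ∈ B, ∑ z' ∈ B,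
        φ (d - z) * φ (d' - z) * (φ (d - z') * φ (d' - z')) =
        ∑ z ∈ B, ∑ z' ∈ B, ∑ d' ∈ C, 
        φ (d - z) * φ (d - z') * (φ (d' - z) * φ (d' - z')) := by
      intro d _
      rw [sum_comm]
      refine sum_congr rfl fun z _ => ?_
      rw [sum_comm]
      refine sum_congr rfl fun z' _ => sum_congr rfl fun d' _ => by ring
    rw [sum_congr rfl this, sum_comm]
    refine sum_congr rfl fun z _ => ?_
    rw [sum_comm]
  rw [e1]
  have e2 : ∀ z ∈ B, ∀ z' ∈ B, (∑ d ∈ C, φ (d - z) * φ (d - z')) ^ 2 ≤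
      cor8 A (z - z') * ∑ x ∈ A, φ x ^ 2 * φ (x + (z - z')) ^ 2 := by
    intro z hz z' _
    have s1 := shift8 A C z (fun x hx => hC x hx z hz) (fun x => φ x * φ (x + (z - z')))
      (fun x hx => by simp [hφ x hx])
    simp only [sub_add_sub_cancel] at s1
    rw [s1]
    have : ∑ x ∈ A, φ x * φ (x + (z - z')) =
        ∑ x ∈ A, ind8 A (x + (z - z')) * (φ x * φ (x + (z - z'))) := by
      refine sum_congr rfl fun x _ => ?_
      by_cases h : x + (z - z') ∈ A
      · rw [ind8_on A _ h, one_mul]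
      · rw [hφ _ h]; simp
    rw [this]
    refine (sum_mul_sq_le_sq_mul_sq _ _ _).trans (le_of_eq ?_)
    simp only [ind8_sq, mul_pow]
    rfl
  refine (sum_le_sum fun z hz => sum_le_sum fun z' hz' => e2 z hz z' hz').trans (le_of_eq ?_)
  have e3 : ∀ t, ∑ x ∈ A, φ x ^ 2 * φ (x + t) ^ 2 =
      ∑ x ∈ A, ∑ y ∈ A, if y - x = t then φ x ^ 2 * φ y ^ 2 else 0 := by
    intro t
    refine sum_congr rfl fun x _ => ?_
    have : ∀ y, (y - x = t) ↔ (y = x + t) := fun d => by rw [sub_eq_iff_eq_add, add_comm]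
    simp only [this]
    rw [Finset.sum_ite_eq' A (x + t) (fun y => φ x ^ 2 * φ y ^ 2)]
    split_ifs with h
    · rfl
    · simp [hφ _ h]
  have e4 : ∀ (x y : G), ∑ z ∈ B, ∑ z' ∈ B, (if y - x = z - z' then cor8 A (z - z') else 0)
      = cor8 A (x - y) ^ 2 := by
    intro x y
    rw [sum_diff8 B (fun t => if y - x = t then cor8 A t else 0)]
    simp only [mul_ite, mul_zero]
    rw [Finset.sum_ite_eq, hB, ← cor8_neg, neg_sub, sq]
    split_ifs with h
    · rfl
    · have : cor8 B (y - x) = 0 := by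
        refine sum_eq_zero fun u hu => ind8_off _ _ fun h' => h ?_
        have := sub_mem_sub h' hu
        simpa using this
      rw [← neg_sub y x, cor8_neg, ← hB, this]; simp
  simp only [e3, mul_sum, ← e4, sum_mul]
  rw [sum4]
  refine sum_congr rfl fun x _ => sum_congr rfl fun y _ => sum_congr rfl fun z _ =>
    sum_congr rfl fun z' _ => ?_
  split_ifs <;> ring

lemma shift2 (A C : Finset G) (z : G) (hz : ∀ x ∈ A, x + z ∈ C) (f : G → G → ℝ)
    (hf : ∀ x y, x ∉ A → f x y = 0) (hg : ∀ x y, y ∉ A → f x y = 0) :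
    ∑ d ∈ C, ∑ d' ∈ C, f (d - z) (d' - z) = ∑ x ∈ A, ∑ y ∈ A, f x y := by
  rw [← shift8 A C z hz (fun x => ∑ y ∈ A, f x y) (fun x hx => sum_eq_zero fun y _ => hf x y hx)]
  exact sum_congr rfl fun d _ => shift8 A C z hz (fun y => f (d - z) y) (fun y hy => hg _ y hy)

/-- number of representations -/
noncomputable def rep8 (A B : Finset G) (d : G) : ℝ := ∑ z ∈ B, ind8 A (d - z)

noncomputable def sig8 (A B : Finset G) (x : G) : ℝ := ∑ z ∈ B, rep8 A B (x + z)

lemma rep8_nonneg (A B : Finset G) (d : G) : 0 ≤ rep8 A B d :=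
  sum_nonneg fun _ _ => ind8_nonneg _ _

lemma rep8_pos (A B : Finset G) (x z : G) (hx : x ∈ A) (hz : z ∈ B) : 0 < rep8 A B (x + z) := by
  refine sum_pos' (fun _ _ => ind8_nonneg _ _) ⟨z, hz, ?_⟩
  rw [add_sub_cancel_right, ind8_on A x hx]; norm_num

lemma sig8_pos (A B : Finset G) (hB : B.Nonempty) (x : G) (hx : x ∈ A) : 0 < sig8 A B x :=
  sum_pos (fun z hz => rep8_pos A B x z hx hz) hB

lemma sum_sig8 (A B : Finset G) (hB : ∀ s, cor8 B s = cor8 A s) :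
    ∑ x ∈ A, sig8 A B x = ∑ s ∈ A - A, cor8 A s ^ 2 := by
  have e : ∑ x ∈ A, sig8 A B x = ∑ z ∈ B, ∑ z' ∈ B, cor8 A (z - z') := by
    simp only [sig8, rep8, cor8]
    rw [sum3]
    simp only [add_sub_assoc]
  rw [e, sum_diff8]
  simp only [hB, ← sq]
  have off : ∀ (S : Finset G) (s : G), s ∉ S - S → cor8 S s = 0 := by
    intro S s h
    refine sum_eq_zero fun u hu => ind8_off _ _ fun h' => h ?_
    have := sub_mem_sub h' hu
    simpa using this
  have h1 : ∑ s ∈ B - B, cor8 A s ^ 2 = ∑ s ∈ (B - B) ∪ (A - A), cor8 A s ^ 2 :=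
    sum_subset subset_union_left fun s _ h => by rw [← hB, off B s h]; norm_num
  have h2 : ∑ s ∈ A - A, cor8 A s ^ 2 = ∑ s ∈ (B - B) ∪ (A - A), cor8 A s ^ 2 :=
    sum_subset subset_union_right fun s _ h => by rw [off A s h]; norm_num
  rw [h1, h2]

lemma step2 (A B C : Finset G) (hC : ∀ x ∈ A, ∀ z ∈ B, x + z ∈ C) (hne : B.Nonempty) :
    (B.card : ℝ) ^ 2 * ∑ x ∈ A, ∑ y ∈ A,
        cor8 A (x - y) ^ 2 * (√(sig8 A B x * sig8 A B y))⁻¹ ≤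
      ∑ d ∈ C, ∑ d' ∈ C, cor8 A (d - d') ^ 2 := by
  have a1 : ∑ d ∈ C, ∑ d' ∈ C, cor8 A (d - d') ^ 2 *
      ((∑ z ∈ B, ind8 A (d - z) * ind8 A (d' - z)) * (√(rep8 A B d * rep8 A B d'))⁻¹) ≤
      ∑ d ∈ C, ∑ d' ∈ C, cor8 A (d - d') ^ 2 := by
    refine sum_le_sum fun d _ => sum_le_sum fun d' _ => ?_
    refine mul_le_of_le_one_right (sq_nonneg _) ?_
    rw [← div_eq_mul_inv]
    refine div_le_one_of_le₀ ?_ (Real.sqrt_nonneg _)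
    refine Real.le_sqrt_of_sq_le ?_
    refine (sum_mul_sq_le_sq_mul_sq _ _ _).trans (le_of_eq ?_)
    simp only [ind8_sq]; rfl
  have a2 : ∑ d ∈ C, ∑ d' ∈ C, cor8 A (d - d') ^ 2 *
      ((∑ z ∈ B, ind8 A (d - z) * ind8 A (d' - z)) * (√(rep8 A B d * rep8 A B d'))⁻¹) =
      ∑ x ∈ A, ∑ y ∈ A, cor8 A (x - y) ^ 2 *
        ∑ z ∈ B, (√(rep8 A B (x + z) * rep8 A B (y + z)))⁻¹ := by
    simp only [mul_sum, sum_mul]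
    rw [← sum3 B C C, ← sum3 B A A]
    refine sum_congr rfl fun z hz => ?_
    have := shift2 A C z (fun x hx => hC x hx z hz) (fun x y => cor8 A (x - y) ^ 2 *
      (ind8 A x * ind8 A y * (√(rep8 A B (x + z) * rep8 A B (y + z)))⁻¹))
      (fun x y h => by simp [ind8_off A x h]) (fun x y h => by simp [ind8_off A y h])
    simp only [sub_sub_sub_cancel_right, sub_add_cancel] at this
    rw [this]
    refine sum_congr rfl fun x hx => sum_congr rfl fun y hy => ?_
    rw [ind8_on A x hx, ind8_on A y hy]; ring
  refine le_trans ?_ (a2 ▸ a1)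
  rw [mul_sum]
  refine sum_le_sum fun x hx => ?_
  rw [mul_sum]
  refine sum_le_sum fun y hy => ?_
  rw [mul_left_comm]
  refine mul_le_mul_of_nonneg_left ?_ (sq_nonneg _)
  have hpos : ∀ z ∈ B, 0 < √(rep8 A B (x + z) * rep8 A B (y + z)) := fun z hz =>
    Real.sqrt_pos.2 (mul_pos (rep8_pos A B x z hx hz) (rep8_pos A B y z hy hz))
  have c1 : (∑ z ∈ B, (1:ℝ)) ^ 2 ≤ (∑ z ∈ B, (√(rep8 A B (x + z) * rep8 A B (y + z)))⁻¹) *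
      ∑ z ∈ B, √(rep8 A B (x + z) * rep8 A B (y + z)) := by
    refine sum_sq_le_sum_mul_sum_of_sq_eq_mul _ (fun z hz => (inv_pos.2 (hpos z hz)).le)
      (fun z hz => (hpos z hz).le) fun z hz => ?_
    rw [inv_mul_cancel₀ (hpos z hz).ne']; norm_num
  have c2 : ∑ z ∈ B, √(rep8 A B (x + z) * rep8 A B (y + z)) ≤ √(sig8 A B x * sig8 A B y) := by
    have := Real.sum_sqrt_mul_sqrt_le B (fun z => rep8_nonneg A B (x + z))
      (fun z => rep8_nonneg A B (y + z))
    rw [Real.sqrt_mul (sig8_pos A B hne x hx).le]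
    simp only [Real.sqrt_mul (rep8_nonneg A B _)]
    exact this
  have c3 : 0 < √(sig8 A B x * sig8 A B y) :=
    Real.sqrt_pos.2 (mul_pos (sig8_pos A B hne x hx) (sig8_pos A B hne y hy))
  rw [← div_eq_mul_inv, div_le_iff₀ c3]
  simp only [sum_const, nsmul_eq_mul, mul_one] at c1
  refine c1.trans (mul_le_mul_of_nonneg_left c2 (sum_nonneg fun z hz => (inv_pos.2 (hpos z hz)).le))

lemma step4 (A : Finset G) (σ : G → ℝ) (hσ : ∀ x ∈ A, 0 < σ x) :
    (A.card : ℝ) ^ 8 ≤ (∑ x ∈ A, (√√(σ x))⁻¹) ^ 4 * ((A.card : ℝ) ^ 3 * ∑ x ∈ A, σ x) := by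
  have hp : ∀ x ∈ A, 0 < √√(σ x) := fun x hx => Real.sqrt_pos.2 (Real.sqrt_pos.2 (hσ x hx))
  have c1 : (∑ x ∈ A, (1:ℝ)) ^ 2 ≤ (∑ x ∈ A, (√√(σ x))⁻¹) * ∑ x ∈ A, √√(σ x) := by
    refine sum_sq_le_sum_mul_sum_of_sq_eq_mul _ (fun z hz => (inv_pos.2 (hp z hz)).le)
      (fun z hz => (hp z hz).le) fun z hz => ?_
    rw [inv_mul_cancel₀ (hp z hz).ne']; norm_num
  have c2 : (∑ x ∈ A, √√(σ x)) ^ 2 ≤ A.card * ∑ x ∈ A, √(σ x) := by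
    refine sq_sum_le_card_mul_sum_sq.trans (le_of_eq ?_)
    simp only [Real.sq_sqrt (Real.sqrt_nonneg _)]
  have c3 : (∑ x ∈ A, √(σ x)) ^ 2 ≤ A.card * ∑ x ∈ A, σ x := by
    refine sq_sum_le_card_mul_sum_sq.trans (le_of_eq ?_)
    congr 1
    exact sum_congr rfl fun x hx => Real.sq_sqrt (hσ x hx).le
  simp only [sum_const, nsmul_eq_mul, mul_one] at c1
  set n : ℝ := (A.card : ℝ)
  have hn : 0 ≤ n := Nat.cast_nonneg _
  set F := ∑ x ∈ A, (√√(σ x))⁻¹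
  set H := ∑ x ∈ A, √√(σ x)
  set K := ∑ x ∈ A, √(σ x)
  set E := ∑ x ∈ A, σ x
  have d1 : (n ^ 2) ^ 4 ≤ (F * H) ^ 4 := pow_le_pow_left₀ (by positivity) c1 4
  have d2 : (H ^ 2) ^ 2 ≤ (n * K) ^ 2 := pow_le_pow_left₀ (by positivity) c2 2
  calc n ^ 8 = (n ^ 2) ^ 4 := by ring
    _ ≤ (F * H) ^ 4 := d1
    _ = F ^ 4 * (H ^ 2) ^ 2 := by ring
    _ ≤ F ^ 4 * (n * K) ^ 2 := by gcongr
    _ = F ^ 4 * (n ^ 2 * K ^ 2) := by ring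
    _ ≤ F ^ 4 * (n ^ 2 * (n * E)) := by gcongr
    _ = _ := by ring

lemma main8 (A B C : Finset G) (hA : A.Nonempty) (hC : ∀ x ∈ A, ∀ z ∈ B, x + z ∈ C)
    (hcard : B.card = A.card) (hB : ∀ s, cor8 B s = cor8 A s) :
    (A.card : ℝ) ^ 13 ≤ (∑ d ∈ C, ∑ d' ∈ C, cor8 A (d - d') ^ 2) ^ 2 *
      ((A - A).card : ℝ) ^ 2 * ∑ s ∈ A - A, cor8 A s ^ 2 := by
  have hBne : B.Nonempty := by
    rw [← card_pos, hcard, card_pos]; exact hA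
  have hσ := sig8_pos A B hBne
  set φ : G → ℝ := fun x => ind8 A x * (√√(sig8 A B x))⁻¹ with hφ
  have hoff : ∀ x, x ∉ A → φ x = 0 := fun x hx => by simp [hφ, ind8_off A x hx]
  have hon : ∀ x ∈ A, φ x = (√√(sig8 A B x))⁻¹ := fun x hx => by simp [hφ, ind8_on A x hx]
  have h2 := step2 A B C hC hBne
  have hW := stepW A B C hC hB φ hoff
  have h3 := step3 A φ
  have h4 := step4 A (sig8 A B) hσ
  rw [← sum_congr rfl hon, sum_sig8 A B hB] at h4
  have hY : ∑ x ∈ A, ∑ y ∈ A, cor8 A (x - y) ^ 2 * (√(sig8 A B x * sig8 A B y))⁻¹ =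
      ∑ x ∈ A, ∑ y ∈ A, cor8 A (x - y) ^ 2 * (φ x ^ 2 * φ y ^ 2) := by
    refine sum_congr rfl fun x hx => sum_congr rfl fun y hy => ?_
    rw [hon x hx, hon y hy, inv_pow, inv_pow, Real.sq_sqrt (Real.sqrt_nonneg _),
      Real.sq_sqrt (Real.sqrt_nonneg _), Real.sqrt_mul (hσ x hx).le, mul_inv]
  rw [hY, hcard] at h2
  have h1 : (∑ d ∈ C, ∑ d' ∈ C, cor8 A (d - d') * ∑ z ∈ B, φ (d - z) * φ (d' - z)) =
      (A.card : ℝ) * ∑ x ∈ A, ∑ y ∈ A, cor8 A (x - y) * (φ x * φ y) := by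
    simp only [mul_sum]
    rw [← sum3]
    have : ∀ z ∈ B, ∑ d ∈ C, ∑ d' ∈ C, cor8 A (d - d') * (φ (d - z) * φ (d' - z)) =
        ∑ x ∈ A, ∑ y ∈ A, cor8 A (x - y) * (φ x * φ y) := by
      intro z hz
      have := shift2 A C z (fun x hx => hC x hx z hz)
        (fun x y => cor8 A (x - y) * (φ x * φ y))
        (fun x y h => by simp [hoff x h]) (fun x y h => by simp [hoff y h])
      simpa only [sub_sub_sub_cancel_right] using this
    rw [sum_congr rfl this, sum_const, nsmul_eq_mul, hcard]
    simp only [mul_sum]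
  have hCS : (∑ d ∈ C, ∑ d' ∈ C, cor8 A (d - d') * ∑ z ∈ B, φ (d - z) * φ (d' - z)) ^ 2 ≤
      (∑ d ∈ C, ∑ d' ∈ C, cor8 A (d - d') ^ 2) *
      ∑ d ∈ C, ∑ d' ∈ C, (∑ z ∈ B, φ (d - z) * φ (d' - z)) ^ 2 := by
    have := sum_mul_sq_le_sq_mul_sq (C ×ˢ C) (fun p => cor8 A (p.1 - p.2))
      (fun p => ∑ z ∈ B, φ (p.1 - z) * φ (p.2 - z))
    simpa only [sum_product] using this
  rw [h1] at hCS
  have hn : (0:ℝ) < A.card := by exact_mod_cast card_pos.2 hA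
  have hX : 0 ≤ ∑ d ∈ C, ∑ d' ∈ C, cor8 A (d - d') ^ 2 :=
    sum_nonneg fun _ _ => sum_nonneg fun _ _ => sq_nonneg _
  have hE : 0 ≤ ∑ s ∈ A - A, cor8 A s ^ 2 := sum_nonneg fun _ _ => sq_nonneg _
  generalize (∑ d ∈ C, ∑ d' ∈ C, cor8 A (d - d') ^ 2) = X at *
  generalize (∑ d ∈ C, ∑ d' ∈ C, (∑ z ∈ B, φ (d - z) * φ (d' - z)) ^ 2) = W at *
  generalize (∑ x ∈ A, ∑ y ∈ A, cor8 A (x - y) ^ 2 * (φ x ^ 2 * φ y ^ 2)) = Y at *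
  generalize (∑ x ∈ A, ∑ y ∈ A, cor8 A (x - y) * (φ x * φ y)) = M at *
  generalize (∑ s ∈ A - A, cor8 A s ^ 2) = E at *
  generalize (∑ x ∈ A, φ x) = F at *
  generalize (A.card : ℝ) = n at *
  generalize ((A - A).card : ℝ) = D at *
  have k1 : n ^ 4 * M ^ 2 ≤ X ^ 2 := by
    calc n ^ 4 * M ^ 2 = n ^ 2 * (n * M) ^ 2 := by ring
      _ ≤ n ^ 2 * (X * W) := by gcongr
      _ ≤ n ^ 2 * (X * Y) := by gcongr
      _ = X * (n ^ 2 * Y) := by ring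
      _ ≤ X * X := by gcongr
      _ = X ^ 2 := by ring
  have k2 : ((n * F) ^ 2) ^ 2 ≤ (D * M) ^ 2 := pow_le_pow_left₀ (by positivity) h3 2
  have k3 : n ^ 5 ≤ F ^ 4 * E := by
    have : n ^ 3 * n ^ 5 ≤ n ^ 3 * (F ^ 4 * E) := by
      calc n ^ 3 * n ^ 5 = n ^ 8 := by ring
        _ ≤ _ := h4
        _ = _ := by ring
    exact le_of_mul_le_mul_left this (by positivity)
  calc n ^ 13 = n ^ 8 * n ^ 5 := by ring
    _ ≤ n ^ 8 * (F ^ 4 * E) := by gcongr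
    _ = n ^ 4 * ((n * F) ^ 2) ^ 2 * E := by ring
    _ ≤ n ^ 4 * (D * M) ^ 2 * E := by gcongr
    _ = (n ^ 4 * M ^ 2) * D ^ 2 * E := by ring
    _ ≤ X ^ 2 * D ^ 2 * E := by gcongr

lemma energy8 (A : Finset G) : (energy A : ℝ) = ∑ s ∈ A - A, cor8 A s ^ 2 := by
  simp only [energy, energyK]
  push_cast
  simp only [stab_card8]

lemma energy3b8 (C A : Finset G) :
    (energy3b C A : ℝ) = ∑ d ∈ C, ∑ d' ∈ C, cor8 A (d - d') ^ 2 := by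
  rw [sum_diff8 C (fun s => cor8 A s ^ 2)]
  simp only [energy3b]
  push_cast
  simp only [stab_card8]

theorem stmt_8 (A : Finset G) (hA : A.Nonempty) :
    A.card ^ 13 ≤ energy3b (A - A) A ^ 2 * (A - A).card ^ 2 * energy A ∧
    A.card ^ 13 ≤ energy3b (A + A) A ^ 2 * (A - A).card ^ 2 * energy A := by
  constructor
  · have h := main8 A (-A) (A - A) hA
      (fun x hx z hz => by
        have := sub_mem_sub hx (Finset.mem_neg'.1 hz)
        simpa using this)
      (Finset.card_neg A) (cor8_neg_set A)
    rw [← energy8, ← energy3b8] at h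
    exact_mod_cast h
  · have h := main8 A A (A + A) hA (fun x hx z hz => add_mem_add hx hz) rfl (fun _ => rfl)
    rw [← energy8, ← energy3b8] at h
    exact_mod_cast h
end
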